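/- Let X be a real normed space containing a sequence (e_i)_{i=1}^∞ with e_1 ≠ e_2 on which the norm is equal-signs-additive (ESA). Then for every integer k ≥ 1 there exist elements x_t, x_{t_1}, x_{s_1}, x_{v_1}, …, x_{v_k} of X with x_t ≠ 0 such that: ‖x_{s_1}‖ = ‖x_t − x_{t_1}‖ = ‖x_{t_1} − x_{v_i}‖ = ‖x_{v_i} − x_{s_1}‖ = (1/4)‖x_t‖ for every i; ‖x_{v_i}‖ = ‖x_t − x_{v_i}‖ = ‖x_{t_1} − x_{s_1}‖ = (1/2)‖x_t‖ for every i; ‖x_{t_1}‖ = ‖x_t − x_{s_1}‖ = (3/4)‖x_t‖; and ‖x_{v_i} − x_{v_j}‖ ≥ (1/8)‖x_t‖ for all i ≠ j. (Together with the point 0 for the bottom vertex, these points realize the Laakso graph L_{1,k} in X with distortion at most 4.) -/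

import Mathlib

noncomputable section

/-- The sequence obtained from `a` by adding together the entries at `k` and `k+1`
(and shifting the later entries down by one). -/
def collapseSeq (a : ℕ → ℝ) (k : ℕ) : ℕ → ℝ :=
  fun i => if i < k then a i else if i = k then a k + a (k + 1) else a (i + 1)

/-- The (finitely supported) sum `∑ᵢ aᵢ • eᵢ`. -/
def esaSum {X : Type} [AddCommGroup X] [Module ℝ X] (e : ℕ → X) (a : ℕ → ℝ) : X :=
  ∑ᶠ i, a i • e i

/-- The norm is equal-signs-additive (ESA) on the sequence `e`: collapsing two
consecutive coefficients of equal signs does not change the norm. -/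
def IsESA {X : Type} [NormedAddCommGroup X] [NormedSpace ℝ X] (e : ℕ → X) : Prop :=
  ∀ a : ℕ → ℝ, (Function.support a).Finite → ∀ k : ℕ, 0 ≤ a k * a (k + 1) →
    ‖esaSum e (collapseSeq a k)‖ = ‖esaSum e a‖

/-- The vector `∑ᵢ lᵢ • e (n + i)` with coefficients listed in `l`. -/
def wordSum {X : Type} [AddCommGroup X] [Module ℝ X] (e : ℕ → X) : ℕ → List ℝ → X
  | _, [] => 0
  | n, a :: l => a • e n + wordSum e (n + 1) l

section WordSum

variable {X : Type} [AddCommGroup X] [Module ℝ X] (e : ℕ → X)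

theorem wordSum_append (l l' : List ℝ) (n : ℕ) :
    wordSum e n (l ++ l') = wordSum e n l + wordSum e (n + l.length) l' := by
  induction l generalizing n with
  | nil => simp [wordSum]
  | cons a l ih => simp [wordSum, ih, add_assoc, add_comm 1]

theorem wordSum_replicate_zero (k n : ℕ) : wordSum e n (List.replicate k 0) = 0 := by
  induction k generalizing n with
  | zero => rfl
  | succ k ih => simp [List.replicate_succ, wordSum, ih]

theorem wordSum_map_sub {ι : Type*} (l : List ι) (f g : ι → ℝ) (n : ℕ) :
    wordSum e n (l.map fun i => f i - g i) =
      wordSum e n (l.map f) - wordSum e n (l.map g) := by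
  induction l generalizing n with
  | nil => simp [wordSum]
  | cons a l ih =>
    simp only [List.map_cons, wordSum, ih, sub_smul]
    abel

theorem wordSum_map_mul (c : ℝ) (l : List ℝ) (n : ℕ) :
    wordSum e n (l.map (c * ·)) = c • wordSum e n l := by
  induction l generalizing n with
  | nil => simp [wordSum]
  | cons a l ih => simp [wordSum, ih, mul_smul]

theorem wordSum_eq_sum (l : List ℝ) (n : ℕ) :
    wordSum e n l = ∑ i ∈ Finset.range l.length, l.getD i 0 • e (n + i) := by
  induction l generalizing n with
  | nil => simp [wordSum]
  | cons a l ih =>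
    rw [wordSum, ih, List.length_cons, Finset.sum_range_succ', add_comm]
    simp [add_assoc, add_comm 1]

theorem support_getD_subset (l : List ℝ) :
    (Function.support fun i => l.getD i 0) ⊆ Finset.range l.length := by
  intro i hi
  by_contra h
  simp only [Finset.coe_range, Set.mem_Iio, not_lt] at h
  exact hi (List.getD_eq_default _ _ h)

theorem esaSum_getD (l : List ℝ) : esaSum e (fun i => l.getD i 0) = wordSum e 0 l := by
  rw [esaSum, wordSum_eq_sum, finsum_eq_sum_of_support_subset (s := Finset.range l.length)]
  · simp
  · refine subset_trans (fun i hi => ?_) (support_getD_subset l)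
    intro h
    simp_all

theorem collapseSeq_getD (p s : List ℝ) (a b : ℝ) :
    collapseSeq (fun i => (p ++ a :: b :: s).getD i 0) p.length =
      fun i => (p ++ (a + b) :: s).getD i 0 := by
  funext i
  simp only [collapseSeq]
  rcases lt_trichotomy i p.length with h | h | h
  · rw [if_pos h, List.getD_append _ _ _ _ h, List.getD_append _ _ _ _ h]
  · subst h
    simp
  · obtain ⟨d, rfl⟩ := Nat.exists_eq_add_of_lt h
    have h1 : p.length + d + 1 + 1 - p.length = d + 2 := by omega
    have h2 : p.length + d + 1 - p.length = d + 1 := by omega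
    rw [if_neg (by omega), if_neg (by omega), List.getD_append_right _ _ _ _ (by omega),
      List.getD_append_right _ _ _ _ (by omega), h1, h2]
    simp

end WordSum

section ESA

variable {X : Type} [NormedAddCommGroup X] [NormedSpace ℝ X] {e : ℕ → X}

/-- In every context, the word `l` has at most the norm of the word `l'`. -/
def WordLE (e : ℕ → X) (l l' : List ℝ) : Prop :=
  ∀ p s : List ℝ, ‖wordSum e 0 (p ++ l ++ s)‖ ≤ ‖wordSum e 0 (p ++ l' ++ s)‖

theorem WordLE.refl (l : List ℝ) : WordLE e l l := fun _ _ => le_rfl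

theorem WordLE.trans {l₁ l₂ l₃ : List ℝ} (h : WordLE e l₁ l₂) (h' : WordLE e l₂ l₃) :
    WordLE e l₁ l₃ := fun p s => (h p s).trans (h' p s)

theorem WordLE.append {l₁ l₂ m₁ m₂ : List ℝ} (h : WordLE e l₁ l₂) (h' : WordLE e m₁ m₂) :
    WordLE e (l₁ ++ m₁) (l₂ ++ m₂) := by
  intro p s
  have h₁ := h p (m₁ ++ s)
  have h₂ := h' (p ++ l₂) s
  simp only [List.append_assoc] at h₁ h₂ ⊢
  exact h₁.trans h₂

theorem WordLE.flatMap {ι : Type*} (B : List ι) {f g : ι → List ℝ}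
    (h : ∀ m, WordLE e (f m) (g m)) : WordLE e (B.flatMap f) (B.flatMap g) := by
  induction B with
  | nil => exact WordLE.refl _
  | cons a B ih =>
    simp only [List.flatMap_cons]
    exact (h a).append ih

theorem WordLE.norm_le {l l' : List ℝ} (h : WordLE e l l') :
    ‖wordSum e 0 l‖ ≤ ‖wordSum e 0 l'‖ := by
  simpa using h [] []

theorem IsESA.norm_merge (he : IsESA e) (p s : List ℝ) {a b : ℝ} (hab : 0 ≤ a * b) :
    ‖wordSum e 0 (p ++ (a + b) :: s)‖ = ‖wordSum e 0 (p ++ a :: b :: s)‖ := by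
  rw [← esaSum_getD, ← esaSum_getD, ← collapseSeq_getD]
  apply he _ ((Finset.finite_toSet _).subset (support_getD_subset _))
  simpa [List.getD_append_right] using hab

theorem IsESA.norm_zero_cons (he : IsESA e) (p s : List ℝ) :
    ‖wordSum e 0 (p ++ 0 :: s)‖ = ‖wordSum e 0 (p ++ s)‖ := by
  cases s with
  | nil => simp [wordSum_append, wordSum]
  | cons b s => simpa using (he.norm_merge p s (a := 0) (b := b) (by simp)).symm

theorem IsESA.norm_replicate_zero (he : IsESA e) (p s : List ℝ) (k : ℕ) :
    ‖wordSum e 0 (p ++ (List.replicate k 0 ++ s))‖ = ‖wordSum e 0 (p ++ s)‖ := by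
  induction k with
  | zero => simp
  | succ k ih => rw [List.replicate_succ, List.cons_append, he.norm_zero_cons, ih]

theorem IsESA.norm_shift (he : IsESA e) (n : ℕ) (l : List ℝ) :
    ‖wordSum e n l‖ = ‖wordSum e 0 l‖ := by
  have h := he.norm_replicate_zero [] l n
  rw [List.nil_append, wordSum_append, wordSum_replicate_zero] at h
  simpa using h

theorem IsESA.norm_apply (he : IsESA e) (n : ℕ) : ‖e n‖ = ‖e 0‖ := by
  simpa [wordSum] using he.norm_shift n [1]

theorem IsESA.norm_append_le (he : IsESA e) (l l' : List ℝ) :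
    ‖wordSum e 0 (l ++ l')‖ ≤ ‖wordSum e 0 l‖ + ‖wordSum e 0 l'‖ := by
  rw [wordSum_append]
  refine (norm_add_le _ _).trans ?_
  rw [he.norm_shift (0 + l.length)]

theorem IsESA.zero_le (he : IsESA e) (k : ℕ) : WordLE e (List.replicate k 0) [] := by
  intro p s
  simp [he.norm_replicate_zero]

theorem IsESA.le_zero (he : IsESA e) (k : ℕ) : WordLE e [] (List.replicate k 0) := by
  intro p s
  simp [he.norm_replicate_zero]

/-- Averaging over translates: an adjacent pair `c, -c` can be deleted. -/
theorem IsESA.nil_le_pair (he : IsESA e) (c : ℝ) : WordLE e [] [c, -c] := by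
  intro p s
  set A := ‖wordSum e 0 (p ++ [] ++ s)‖ with hA
  set D := ‖wordSum e 0 (p ++ [c, -c] ++ s)‖ with hD
  have key : ∀ n : ℕ, n * (A - D) ≤ 2 * |c| * ‖e 0‖ := by
    intro n
    let w : ℕ → X := fun i => wordSum e 0 (p ++ (List.replicate i 0 ++
      ([c, -c] ++ (List.replicate (n - 1 - i) 0 ++ s))))
    let z : X := wordSum e 0 (p ++ (List.replicate (n + 1) 0 ++ s))
    have hw : ∀ i, ‖w i‖ = D := by
      intro i
      have h₁ := he.norm_replicate_zero p ([c, -c] ++ (List.replicate (n - 1 - i) 0 ++ s)) i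
      have h₂ := he.norm_replicate_zero (p ++ [c, -c]) s (n - 1 - i)
      simp only [w, hD]
      rw [h₁, ← h₂]
      simp only [List.append_assoc]
    have hz : ‖z‖ = A := by
      simp only [z, hA]
      rw [he.norm_replicate_zero]
      simp
    have hwz : ∀ i ∈ Finset.range n,
        w i = z + c • (e (p.length + i) - e (p.length + (i + 1))) := by
      intro i hi
      have hi' := Finset.mem_range.1 hi
      have hl : p.length + i + 2 + (n - 1 - i) = p.length + (n + 1) := by omega
      simp only [w, z, wordSum_append, wordSum_replicate_zero, wordSum, List.length_replicate,
        List.length_cons, List.length_nil, zero_add, hl, smul_sub, neg_smul, add_zero]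
      simp only [add_assoc]
      abel
    have hsum : ∑ i ∈ Finset.range n, w i =
        n • z + c • (e p.length - e (p.length + n)) := by
      rw [Finset.sum_congr rfl hwz, Finset.sum_add_distrib, ← Finset.smul_sum,
        Finset.sum_range_sub' (fun i => e (p.length + i))]
      simp
    have h₁ : ‖n • z‖ ≤ ‖∑ i ∈ Finset.range n, w i‖ +
        ‖c • (e p.length - e (p.length + n))‖ := by
      rw [eq_sub_of_add_eq hsum.symm]
      exact norm_sub_le _ _
    have h₂ : ‖∑ i ∈ Finset.range n, w i‖ ≤ n * D := by
      refine (norm_sum_le _ _).trans ?_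
      simp [hw]
    have h₃ : ‖c • (e p.length - e (p.length + n))‖ ≤ |c| * (‖e 0‖ + ‖e 0‖) := by
      rw [norm_smul, Real.norm_eq_abs]
      gcongr
      refine (norm_sub_le _ _).trans ?_
      rw [he.norm_apply, he.norm_apply (p.length + n)]
    have h₄ : ‖n • z‖ = n * A := by
      rw [← Nat.cast_smul_eq_nsmul ℝ, norm_smul, hz]
      simp
    linarith
  by_contra! h
  obtain ⟨n, hn⟩ := exists_nat_gt (2 * |c| * ‖e 0‖ / (A - D))
  rw [div_lt_iff₀ (by linarith)] at hn
  exact absurd (key n) (not_le.2 hn)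

theorem IsESA.merge_le (he : IsESA e) {a b : ℝ} (hab : 0 ≤ a * b) :
    WordLE e [a, b] [a + b] := by
  intro p s
  simpa using (he.norm_merge p s hab).ge

theorem IsESA.le_merge (he : IsESA e) {a b : ℝ} (hab : 0 ≤ a * b) :
    WordLE e [a + b] [a, b] := by
  intro p s
  simpa using (he.norm_merge p s hab).le

theorem IsESA.four_merge (he : IsESA e) {a b c d : ℝ} (h₁ : 0 ≤ a * b)
    (h₂ : 0 ≤ (a + b) * c) (h₃ : 0 ≤ (a + b + c) * d) :
    WordLE e [a, b, c, d] [a + b + c + d] ∧ WordLE e [a + b + c + d] [a, b, c, d] :=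
  ⟨((he.merge_le h₁).append (WordLE.refl [c, d])).trans
      (((he.merge_le h₂).append (WordLE.refl [d])).trans (he.merge_le h₃)),
    ((he.le_merge h₃).trans ((he.le_merge h₂).append (WordLE.refl [d]))).trans
      ((he.le_merge h₁).append (WordLE.refl [c, d]))⟩

/-- A block of four coefficients of one sign with sum `c` followed by four of the opposite sign
with sum `-c`. -/
structure IsBalancedBlock (c : ℝ) (g : Fin 8 → ℝ) : Prop where
  nonneg : 0 ≤ g 0 ∧ 0 ≤ g 1 ∧ 0 ≤ g 2 ∧ 0 ≤ g 3
  nonpos : g 4 ≤ 0 ∧ g 5 ≤ 0 ∧ g 6 ≤ 0 ∧ g 7 ≤ 0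
  sum_left : g 0 + g 1 + g 2 + g 3 = c
  sum_right : g 4 + g 5 + g 6 + g 7 = -c

theorem IsESA.block_merge (he : IsESA e) {c : ℝ} {g : Fin 8 → ℝ} (hg : IsBalancedBlock c g) :
    WordLE e (List.ofFn g) [c, -c] ∧ WordLE e [c, -c] (List.ofFn g) := by
  obtain ⟨⟨h0, h1, h2, h3⟩, ⟨h4, h5, h6, h7⟩, hl, hr⟩ := hg
  have hL := he.four_merge (mul_nonneg h0 h1) (mul_nonneg (add_nonneg h0 h1) h2)
    (mul_nonneg (add_nonneg (add_nonneg h0 h1) h2) h3)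
  have hR := he.four_merge (mul_nonneg_of_nonpos_of_nonpos h4 h5)
    (mul_nonneg_of_nonpos_of_nonpos (add_nonpos h4 h5) h6)
    (mul_nonneg_of_nonpos_of_nonpos (add_nonpos (add_nonpos h4 h5) h6) h7)
  rw [hl] at hL
  rw [hr] at hR
  have hw : List.ofFn g = [g 0, g 1, g 2, g 3] ++ [g 4, g 5, g 6, g 7] := by
    simp [List.ofFn_succ]
  rw [hw]
  exact ⟨hL.1.append hR.1, hL.2.append hR.2⟩

/-- The vector whose coefficients are the concatenated blocks `f m`, for `m` in the list `B`. -/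
def blockSum {ι : Type*} (e : ℕ → X) (B : List ι) (f : ι → Fin 8 → ℝ) : X :=
  wordSum e 0 (B.flatMap fun m => List.ofFn (f m))

theorem blockSum_sub {ι : Type*} (B : List ι) (f g : ι → Fin 8 → ℝ) :
    blockSum e B f - blockSum e B g = blockSum e B (f - g) := by
  have h : ∀ f : ι → Fin 8 → ℝ, (B.flatMap fun m => List.ofFn (f m)) =
      (B.flatMap fun m => List.ofFn fun j : Fin 8 => (m, j)).map fun q => f q.1 q.2 := by
    intro f
    rw [List.map_flatMap]
    simp only [List.map_ofFn, Function.comp_def]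
  simp only [blockSum, h]
  rw [← wordSum_map_sub]
  rfl

/-- The alternating word `1, -1, 1, -1, …` of length `2 * n`. -/
def altWord (n : ℕ) : List ℝ := (List.replicate n ()).flatMap fun _ => [1, -1]

theorem altWord_succ (n : ℕ) : altWord (n + 1) = [1, -1] ++ altWord n := by
  simp [altWord, List.replicate_succ]

theorem altWord_add (m n : ℕ) : altWord (m + n) = altWord m ++ altWord n := by
  rw [altWord, List.replicate_add, List.flatMap_append]
  rfl

theorem flatMap_const_altWord {ι : Type*} (B : List ι) (r : ℕ) :
    (B.flatMap fun _ => altWord r) = altWord (r * B.length) := by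
  induction B with
  | nil => rfl
  | cons a B ih => rw [List.flatMap_cons, ih, ← altWord_add, List.length_cons]; ring_nf

theorem IsESA.norm_blockSum (he : IsESA e) {ι : Type*} (B : List ι) {f : ι → Fin 8 → ℝ} {c : ℝ}
    (hc : 0 ≤ c) (hf : ∀ m, IsBalancedBlock c (f m)) :
    ‖blockSum e B f‖ = c * ‖wordSum e 0 (altWord B.length)‖ := by
  have h₁ : ‖blockSum e B f‖ = ‖wordSum e 0 (B.flatMap fun _ => [c, -c])‖ :=
    le_antisymm (WordLE.flatMap B fun m => (he.block_merge (hf m)).1).norm_le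
      (WordLE.flatMap B fun m => (he.block_merge (hf m)).2).norm_le
  have h₂ : (B.flatMap fun _ => [c, -c]) = (altWord B.length).map (c * ·) := by
    rw [← one_mul B.length, ← flatMap_const_altWord, List.map_flatMap]
    simp [altWord]
  rw [h₁, h₂, wordSum_map_mul, norm_smul, Real.norm_of_nonneg hc]

theorem IsESA.norm_altWord_pos (he : IsESA e) (hne : e 0 ≠ e 1) {n : ℕ} (hn : n ≠ 0) :
    0 < ‖wordSum e 0 (altWord n)‖ := by
  have h : ∀ n, WordLE e [] (altWord n) := by
    intro n
    induction n with
    | zero => exact WordLE.refl _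
    | succ n ih =>
      rw [altWord_succ]
      exact (he.nil_le_pair 1).append ih
  obtain ⟨n, rfl⟩ := Nat.exists_eq_succ_of_ne_zero hn
  have h₁ := ((WordLE.refl [1, -1]).append (h n)).norm_le
  rw [← altWord_succ] at h₁
  refine lt_of_lt_of_le ?_ h₁
  simpa [wordSum, ← sub_eq_add_neg, sub_eq_zero] using hne

/-- If the nonzero blocks of `f` are `±(0, 1, -1, 0, 0, 1, -1, 0)`, then the positive ones bound the
norm from below. -/
theorem IsESA.norm_altWord_le_blockSum (he : IsESA e) {ι : Type*} (B : List ι)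
    {f : ι → Fin 8 → ℝ} (P : ι → Bool) (hP : ∀ m, P m = true → f m = ![0, 1, -1, 0, 0, 1, -1, 0])
    (hN : ∀ m, P m = false → f m = 0 ∨ f m = ![0, -1, 1, 0, 0, -1, 1, 0]) :
    ‖wordSum e 0 (altWord (2 * (B.filter P).length))‖ ≤ ‖blockSum e B f‖ := by
  have h : ∀ m, WordLE e (if P m then altWord 2 else []) (List.ofFn (f m)) := by
    intro m
    cases hm : P m with
    | true =>
      have h₁ := ((he.le_zero 1).append (WordLE.refl [1, -1])).append
        ((he.le_zero 2).append ((WordLE.refl [1, -1]).append (he.le_zero 1)))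
      rw [hP m hm]
      simpa [altWord, List.replicate_succ, List.ofFn_succ] using h₁
    | false =>
      rcases hN m hm with h' | h'
      · have h₁ := he.le_zero 8
        rw [h']
        simpa [List.replicate_succ, List.ofFn_succ] using h₁
      · have h₁ := ((he.le_zero 1).append (he.nil_le_pair (-1))).append
          ((he.le_zero 2).append ((he.nil_le_pair (-1)).append (he.le_zero 1)))
        rw [h']
        simpa [List.replicate_succ, List.ofFn_succ] using h₁
  have h₁ := (WordLE.flatMap B h).norm_le
  have h₂ : (B.flatMap fun m => if P m then altWord 2 else []) =
      altWord (2 * (B.filter P).length) := by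
    rw [← flatMap_const_altWord]
    clear h₁
    induction B with
    | nil => rfl
    | cons a B ih => cases ha : P a <;> simp [ha, ih]
  rwa [h₂] at h₁

end ESA

/-- A quarter of all Boolean vectors take two prescribed values at two given coordinates. -/
theorem four_mul_card_filter_true_false {k : ℕ} {i j : Fin k} (hij : i ≠ j) :
    4 * (Finset.univ.filter fun m : Fin k → Bool => (m i, m j) = (true, false)).card =
      (Finset.univ : Finset (Fin k → Bool)).card := by
  have h : ∀ q ∈ (Finset.univ : Finset (Bool × Bool)),
      (Finset.univ.filter fun m : Fin k → Bool => (m i, m j) = q).card =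
        (Finset.univ.filter fun m : Fin k → Bool => (m i, m j) = (true, false)).card := by
    rintro ⟨a, b⟩ -
    refine Finset.card_nbij' (fun m => Function.update (Function.update m i true) j false)
      (fun m => Function.update (Function.update m i a) j b) ?_ ?_ ?_ ?_
    · intro m _
      simp [hij]
    · intro m _
      simp [hij]
    · intro m hm
      simp only [Finset.coe_filter, Finset.mem_univ, true_and, Set.mem_ofPred_eq,
        Prod.mk.injEq] at hm
      funext l
      by_cases hlj : l = j
      · simp [hlj, hm.2]
      · by_cases hli : l = i <;> simp [hlj, hli, hij, hm.1]
    · intro m hm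
      simp only [Finset.coe_filter, Finset.mem_univ, true_and, Set.mem_ofPred_eq,
        Prod.mk.injEq] at hm
      funext l
      by_cases hlj : l = j
      · simp [hlj, hm.2]
      · by_cases hli : l = i <;> simp [hlj, hli, hij, hm.1]
  rw [Finset.card_eq_sum_card_fiberwise (s := Finset.univ) (f := fun m : Fin k → Bool => (m i, m j))
    (t := Finset.univ) (by simp), Finset.sum_congr rfl h]
  simp

/-- The block of coefficients of a middle vertex of the Laakso graph. -/
def middleBlock (b : Bool) : Fin 8 → ℝ :=
  if b then ![1, 1, 0, 0, -1, 0, -1, 0] else ![1, 0, 1, 0, -1, -1, 0, 0]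

/-- In a real normed space with an ESA sequence `(eᵢ)` satisfying `e 0 ≠ e 1`, for every
`k ≥ 1` there are points `x_t, x_{t₁}, x_{s₁}, x_{v₁}, …, x_{v_k}` (together with `0` for
the bottom vertex) realizing the Laakso graph `L_{1,k}` in `X` with distortion at most `4`:
all the indicated distances are exact multiples of `‖x_t‖`, and the `k` middle points are
pairwise `(1/8)‖x_t‖`-separated. -/
theorem esa_space_realizes_laakso_L1k
    (X : Type) [NormedAddCommGroup X] [NormedSpace ℝ X]
    (e : ℕ → X) (he : IsESA e) (hne : e 0 ≠ e 1) :
    ∀ k : ℕ, 1 ≤ k →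
      ∃ (xt xt₁ xs₁ : X) (xv : Fin k → X), xt ≠ 0 ∧
        (‖xs₁‖ = (1 / 4) * ‖xt‖ ∧ ‖xt - xt₁‖ = (1 / 4) * ‖xt‖ ∧
          ∀ i : Fin k, ‖xt₁ - xv i‖ = (1 / 4) * ‖xt‖ ∧ ‖xv i - xs₁‖ = (1 / 4) * ‖xt‖) ∧
        ((∀ i : Fin k, ‖xv i‖ = (1 / 2) * ‖xt‖ ∧ ‖xt - xv i‖ = (1 / 2) * ‖xt‖) ∧
          ‖xt₁ - xs₁‖ = (1 / 2) * ‖xt‖) ∧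
        (‖xt₁‖ = (3 / 4) * ‖xt‖ ∧ ‖xt - xs₁‖ = (3 / 4) * ‖xt‖) ∧
        (∀ i j : Fin k, i ≠ j → (1 / 8) * ‖xt‖ ≤ ‖xv i - xv j‖) := by
  intro k _
  let B : List (Fin k → Bool) := (Finset.univ : Finset (Fin k → Bool)).toList
  set A := ‖wordSum e 0 (altWord B.length)‖ with hA
  let T : (Fin k → Bool) → Fin 8 → ℝ := fun _ => ![1, 1, 1, 1, -1, -1, -1, -1]
  let T₁ : (Fin k → Bool) → Fin 8 → ℝ := fun _ => ![1, 1, 1, 0, -1, -1, -1, 0]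
  let S₁ : (Fin k → Bool) → Fin 8 → ℝ := fun _ => ![1, 0, 0, 0, -1, 0, 0, 0]
  let V : Fin k → (Fin k → Bool) → Fin 8 → ℝ := fun i m => middleBlock (m i)
  have norm_eq : ∀ {c : ℝ} {f : (Fin k → Bool) → Fin 8 → ℝ}, 0 ≤ c →
      (∀ m, IsBalancedBlock c (f m)) → ‖blockSum e B f‖ = c * A :=
    fun hc hf => he.norm_blockSum B hc hf
  have hBlen : B.length = (Finset.univ : Finset (Fin k → Bool)).card := Finset.length_toList _
  have hApos : 0 < A := he.norm_altWord_pos hne (by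
    rw [hBlen]
    exact Finset.card_ne_zero.2 Finset.univ_nonempty)
  have hT : ‖blockSum e B T‖ = 4 * A :=
    norm_eq (by norm_num) fun m => by constructor <;> simp [T] <;> norm_num
  have hT₁ : ‖blockSum e B T₁‖ = 3 * A :=
    norm_eq (by norm_num) fun m => by constructor <;> simp [T₁] <;> norm_num
  have hS₁ : ‖blockSum e B S₁‖ = 1 * A :=
    norm_eq (by norm_num) fun m => by constructor <;> simp [S₁]
  have hV : ∀ i, ‖blockSum e B (V i)‖ = 2 * A := fun i =>
    norm_eq (by norm_num) fun m => by
      cases hm : m i <;> constructor <;> simp [V, hm, middleBlock] <;> norm_num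
  have hTT₁ : ‖blockSum e B T - blockSum e B T₁‖ = 1 * A := by
    rw [blockSum_sub]
    exact norm_eq (by norm_num) fun m => by constructor <;> simp [T, T₁]
  have hTS₁ : ‖blockSum e B T - blockSum e B S₁‖ = 3 * A := by
    rw [blockSum_sub]
    exact norm_eq (by norm_num) fun m => by constructor <;> simp [T, S₁] <;> norm_num
  have hT₁S₁ : ‖blockSum e B T₁ - blockSum e B S₁‖ = 2 * A := by
    rw [blockSum_sub]
    exact norm_eq (by norm_num) fun m => by constructor <;> simp [T₁, S₁] <;> norm_num
  have hTV : ∀ i, ‖blockSum e B T - blockSum e B (V i)‖ = 2 * A := fun i => by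
    rw [blockSum_sub]
    exact norm_eq (by norm_num) fun m => by
      cases hm : m i <;> constructor <;> simp [T, V, hm, middleBlock] <;> norm_num
  have hT₁V : ∀ i, ‖blockSum e B T₁ - blockSum e B (V i)‖ = 1 * A := fun i => by
    rw [blockSum_sub]
    exact norm_eq (by norm_num) fun m => by
      cases hm : m i <;> constructor <;> simp [T₁, V, hm, middleBlock]
  have hVS₁ : ∀ i, ‖blockSum e B (V i) - blockSum e B S₁‖ = 1 * A := fun i => by
    rw [blockSum_sub]
    exact norm_eq (by norm_num) fun m => by
      cases hm : m i <;> constructor <;> simp [S₁, V, hm, middleBlock]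
  have hVV : ∀ i j, i ≠ j → A ≤ 2 * ‖blockSum e B (V i) - blockSum e B (V j)‖ := by
    intro i j hij
    let P : (Fin k → Bool) → Bool := fun m => decide ((m i, m j) = (true, false))
    have hcard : (B.filter P).length + (B.filter P).length +
        ((B.filter P).length + (B.filter P).length) = B.length := by
      have h₁ : (B.filter P).length =
          (Finset.univ.filter fun m : Fin k → Bool => (m i, m j) = (true, false)).card := by
        rw [← List.toFinset_card_of_nodup ((Finset.nodup_toList _).filter _)]
        congr 1
        ext m
        simp [P]
      have h₂ := four_mul_card_filter_true_false hij
      omega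
    have h₁ : ‖wordSum e 0 (altWord (2 * (B.filter P).length))‖ ≤
        ‖blockSum e B (V i) - blockSum e B (V j)‖ := by
      rw [blockSum_sub]
      apply he.norm_altWord_le_blockSum B P
      · intro m hm
        simp only [P, decide_eq_true_eq, Prod.mk.injEq] at hm
        ext l
        fin_cases l <;> simp [V, hm, middleBlock]
      · intro m hm
        cases hi : m i <;> cases hj : m j <;> simp [P, V, hi, hj, middleBlock] at hm ⊢
        ext l
        fin_cases l
        rfl
    have h₂ : A ≤ ‖wordSum e 0 (altWord (2 * (B.filter P).length))‖ +
        ‖wordSum e 0 (altWord (2 * (B.filter P).length))‖ := by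
      rw [hA, ← hcard, altWord_add, ← two_mul]
      exact he.norm_append_le _ _
    linarith
  refine ⟨blockSum e B T, blockSum e B T₁, blockSum e B S₁, fun i => blockSum e B (V i),
    norm_pos_iff.1 (by rw [hT]; linarith), ⟨?_, ?_, fun i => ⟨?_, ?_⟩⟩,
    ⟨fun i => ⟨?_, ?_⟩, ?_⟩, ⟨?_, ?_⟩, fun i j hij => ?_⟩
  · linarith
  · linarith
  · linarith [hT₁V i]
  · linarith [hVS₁ i]
  · linarith [hV i]
  · linarith [hTV i]
  · linarith
  · linarith
  · linarith
  · linarith [hVV i j hij]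

end
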